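/- Every triangulated surface with exactly 7 vertices and Euler characteristic 0 is orientable, and any two such triangulated surfaces are combinatorially isomorphic; i.e., Möbius' 7-vertex torus is the unique 7-vertex triangulation with Euler characteristic 0 up to combinatorial isomorphism. -/

import Mathlib

open scoped Classical

/-- A triangulated surface on the vertex set `Fin n`: a finite 2-dimensional simplicial
complex given by its set of triangles, which is connected, in which every vertex lies in
some triangle, every edge lies in exactly two triangles, and the link of every vertex is
a single cycle (encoded as: the link graph of every vertex is connected; together with the
condition that every edge lies in exactly two triangles this makes every vertex link a
single circle). -/
structure TriSurface (n : ℕ) where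
  faces : Finset (Finset (Fin n))
  card_eq : ∀ f ∈ faces, f.card = 3
  vertex_mem : ∀ v : Fin n, ∃ f ∈ faces, v ∈ f
  edge_two : ∀ u v : Fin n, u ≠ v → (∃ f ∈ faces, u ∈ f ∧ v ∈ f) →
      (faces.filter (fun f => u ∈ f ∧ v ∈ f)).card = 2
  conn : ∀ u v : Fin n,
      Relation.ReflTransGen (fun a b : Fin n => ∃ f ∈ faces, a ∈ f ∧ b ∈ f) u v
  link_cycle : ∀ v a b : Fin n,
      (∃ f ∈ faces, v ∈ f ∧ a ∈ f ∧ a ≠ v) →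
      (∃ f ∈ faces, v ∈ f ∧ b ∈ f ∧ b ≠ v) →
      Relation.ReflTransGen
        (fun x y : Fin n => x ≠ y ∧ x ≠ v ∧ y ≠ v ∧ ({v, x, y} : Finset (Fin n)) ∈ faces)
        a b

/-- The edges of a triangulated surface: all 2-element vertex sets contained in a triangle. -/
noncomputable def TriSurface.edges {n : ℕ} (S : TriSurface n) : Finset (Finset (Fin n)) :=
  Finset.univ.filter (fun e => e.card = 2 ∧ ∃ f ∈ S.faces, e ⊆ f)

/-- The Euler characteristic χ = f₀ - f₁ + f₂ of a triangulated surface. -/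
noncomputable def TriSurface.eulerChar {n : ℕ} (S : TriSurface n) : ℤ :=
  (n : ℤ) - (S.edges.card : ℤ) + (S.faces.card : ℤ)

/-- Combinatorial isomorphism: a bijection of the vertices mapping triangles to triangles. -/
def TriSurface.Iso {n : ℕ} (S T : TriSurface n) : Prop :=
  ∃ σ : Equiv.Perm (Fin n), ∀ f : Finset (Fin n), f ∈ S.faces ↔ f.image σ ∈ T.faces

/-- Orientability: each triangle can be given a cyclic orientation (recorded as the set of
its three induced directed edges) such that the two orientations induced on each edge by
the two triangles containing it are opposite (no directed edge is induced twice). -/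
def TriSurface.Orientable {n : ℕ} (S : TriSurface n) : Prop :=
  ∃ ω : Finset (Fin n) → Finset (Fin n × Fin n),
    (∀ f ∈ S.faces, ∃ a b c : Fin n, a ≠ b ∧ a ≠ c ∧ b ≠ c ∧
        f = {a, b, c} ∧ ω f = {(a, b), (b, c), (c, a)}) ∧
    (∀ f ∈ S.faces, ∀ g ∈ S.faces, f ≠ g → ∀ p ∈ ω f, p ∉ ω g)

/-- The edge `uv` is contractible: the only common neighbours of `u` and `v` are the two
vertices `w`, `z` with `uvw`, `uvz` triangles, and the edge `wz` is not contained in both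
the link of `u` and the link of `v`. -/
def TriSurface.Contractible {n : ℕ} (S : TriSurface n) (u v : Fin n) : Prop :=
  ({u, v} : Finset (Fin n)) ∈ S.edges ∧
  (∀ w : Fin n, w ≠ u → w ≠ v →
      ({u, w} : Finset (Fin n)) ∈ S.edges → ({v, w} : Finset (Fin n)) ∈ S.edges →
      ({u, v, w} : Finset (Fin n)) ∈ S.faces) ∧
  ¬ ∃ w z : Fin n, ({u, v, w} : Finset (Fin n)) ∈ S.faces ∧
      ({u, v, z} : Finset (Fin n)) ∈ S.faces ∧ w ≠ z ∧
      ({u, w, z} : Finset (Fin n)) ∈ S.faces ∧ ({v, w, z} : Finset (Fin n)) ∈ S.faces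

/-- A triangulated surface is irreducible if it has no contractible edge. -/
def TriSurface.Irreducible {n : ℕ} (S : TriSurface n) : Prop :=
  ¬ ∃ u v : Fin n, S.Contractible u v

/-- The simplices of the complex: the nonempty subsets of triangles. -/
def TriSurface.IsSimplex {n : ℕ} (S : TriSurface n) (σ : Finset (Fin n)) : Prop :=
  σ.Nonempty ∧ ∃ f ∈ S.faces, σ ⊆ f

/-- A geometric realization in ℝ³: each triangle is mapped to affinely independent points,
and the convex hulls of the point sets of any two simplices of the complex intersect
exactly in the convex hull of the points of their common vertices. -/
def TriSurface.IsRealization {n : ℕ} (S : TriSurface n) (p : Fin n → (Fin 3 → ℝ)) : Prop :=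
  (∀ f ∈ S.faces, AffineIndependent ℝ (fun x : {x // x ∈ f} => p x.1)) ∧
  ∀ σ τ : Finset (Fin n), S.IsSimplex σ → S.IsSimplex τ →
    convexHull ℝ (p '' ↑σ) ∩ convexHull ℝ (p '' ↑τ) = convexHull ℝ (p '' ↑(σ ∩ τ))

/-- Neighborly: every pair of distinct vertices forms an edge. -/
def TriSurface.Neighborly {n : ℕ} (S : TriSurface n) : Prop :=
  ∀ u v : Fin n, u ≠ v → ({u, v} : Finset (Fin n)) ∈ S.edges

theorem not_eight_distinct (l : List (Fin 7)) (hl : l.length = 8) : ¬ l.Nodup := by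
  intro hn
  have := hn.length_le_card
  simp [hl] at this

namespace TriSurface

variable {n : ℕ}

/-- Double counting of incident edge-triangle pairs. -/
theorem two_mul_card_edges (S : TriSurface n) : 2 * S.edges.card = 3 * S.faces.card := by
  have h := Finset.sum_card_bipartiteAbove_eq_sum_card_bipartiteBelow
    (s := S.edges) (t := S.faces) (fun e f => e ⊆ f)
  have hl : ∀ e ∈ S.edges, (Finset.bipartiteAbove (fun e f => e ⊆ f) S.faces e).card = 2 := by
    intro e he
    obtain ⟨hc, f, hf, hef⟩ : e.card = 2 ∧ ∃ f ∈ S.faces, e ⊆ f := by simpa [edges] using he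
    obtain ⟨u, v, huv, rfl⟩ := Finset.card_eq_two.mp hc
    have := S.edge_two u v huv ⟨f, hf, hef (by simp), hef (by simp)⟩
    rw [← this]
    congr 1
    ext g
    simp [Finset.bipartiteAbove, Finset.insert_subset_iff]
  have hr : ∀ f ∈ S.faces, (Finset.bipartiteBelow (fun e f => e ⊆ f) S.edges f).card = 3 := by
    intro f hf
    have : Finset.bipartiteBelow (fun e f => e ⊆ f) S.edges f = f.powersetCard 2 := by
      ext e
      simp only [Finset.bipartiteBelow, edges, Finset.mem_filter, Finset.mem_univ, true_and,
        Finset.mem_powersetCard]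
      exact ⟨fun h => ⟨h.2, h.1.1⟩, fun h => ⟨⟨h.2, f, hf, h.1⟩, h.1⟩⟩
    rw [this, Finset.card_powersetCard, S.card_eq f hf]
    rfl
  rw [Finset.sum_congr rfl hl, Finset.sum_congr rfl hr] at h
  simpa [mul_comm] using h

theorem exists_face_of_eulerChar_eq_zero (S : TriSurface 7) (h : S.eulerChar = 0)
    (u v : Fin 7) (huv : u ≠ v) : ∃ f ∈ S.faces, u ∈ f ∧ v ∈ f := by
  have h2 := S.two_mul_card_edges
  have hcard : S.edges.card = 21 := by
    unfold eulerChar at h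
    push_cast at h
    omega
  have hsub : S.edges ⊆ (Finset.univ : Finset (Fin 7)).powersetCard 2 := by
    intro e he
    simp only [edges, Finset.mem_filter] at he
    simpa using he.2.1
  have heq := Finset.eq_of_subset_of_card_le hsub (by simp [hcard, Nat.choose])
  have hmem : ({u, v} : Finset (Fin 7)) ∈ S.edges := by
    rw [heq]
    simp [Finset.card_pair huv]
  simp only [edges, Finset.mem_filter] at hmem
  obtain ⟨f, hf, hs⟩ := hmem.2.2
  exact ⟨f, hf, hs (by simp), hs (by simp)⟩

theorem ne_of_mem_faces (S : TriSurface n) {a b c : Fin n}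
    (h : ({a, b, c} : Finset (Fin n)) ∈ S.faces) : a ≠ b ∧ a ≠ c ∧ b ≠ c := by
  have := S.card_eq _ h
  refine ⟨?_, ?_, ?_⟩ <;> rintro rfl
  · have := Finset.card_le_two (a := a) (b := c)
    simp_all
  · have := Finset.card_le_two (a := b) (b := a)
    simp_all
  · have := Finset.card_le_two (a := a) (b := b)
    simp_all

/-- An edge has exactly two opposite vertices. -/
theorem card_opposite (S : TriSurface n) {u v : Fin n} (huv : u ≠ v)
    (h : ∃ f ∈ S.faces, u ∈ f ∧ v ∈ f) :
    (Finset.univ.filter fun c => ({u, v, c} : Finset (Fin n)) ∈ S.faces).card = 2 := by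
  rw [← S.edge_two u v huv h]
  refine Finset.card_bij (fun c _ => {u, v, c}) ?_ ?_ ?_
  · intro c hc
    simpa using hc
  · intro c hc d hd hcd
    have h1 := S.ne_of_mem_faces (Finset.mem_filter.mp hc).2
    have : c ∈ ({u, v, d} : Finset (Fin n)) := by
      rw [← hcd]
      simp
    simp only [Finset.mem_insert, Finset.mem_singleton] at this
    grind
  · intro f hf
    simp only [Finset.mem_filter] at hf
    obtain ⟨hf, hu, hv⟩ := hf
    have hsub : ({u, v} : Finset (Fin n)) ⊆ f := by simp [Finset.insert_subset_iff, hu, hv]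
    obtain ⟨c, hc⟩ : (f \ {u, v}).Nonempty := by
      rw [← Finset.card_pos, Finset.card_sdiff_of_subset hsub, S.card_eq f hf,
        Finset.card_pair huv]
      norm_num
    simp only [Finset.mem_sdiff, Finset.mem_insert, Finset.mem_singleton, not_or] at hc
    have heq : ({u, v, c} : Finset (Fin n)) = f := by
      refine Finset.eq_of_subset_of_card_le ?_ ?_
      · simp [Finset.insert_subset_iff, hu, hv, hc.1]
      · rw [S.card_eq f hf, Finset.card_eq_three.mpr
          ⟨u, v, c, huv, Ne.symm hc.2.1, Ne.symm hc.2.2, rfl⟩]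
    exact ⟨c, by simpa [heq] using hf, heq⟩

/-- The two opposite vertices of an edge, given one of them. -/
theorem exists_other_opposite (S : TriSurface n) {u v c : Fin n}
    (hc : ({u, v, c} : Finset (Fin n)) ∈ S.faces) :
    ∃ d, d ≠ c ∧ ({u, v, d} : Finset (Fin n)) ∈ S.faces ∧
      ∀ e, ({u, v, e} : Finset (Fin n)) ∈ S.faces → e = c ∨ e = d := by
  have h := S.card_opposite (S.ne_of_mem_faces hc).1 ⟨_, hc, by simp, by simp⟩
  obtain ⟨x, y, hxy, hs⟩ := Finset.card_eq_two.mp h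
  have hm : ∀ e, ({u, v, e} : Finset (Fin n)) ∈ S.faces ↔ e = x ∨ e = y := by
    intro e
    simpa using Finset.ext_iff.mp hs e
  rcases (hm c).mp hc with rfl | rfl
  · exact ⟨y, hxy.symm, (hm y).mpr (Or.inr rfl), fun e => (hm e).mp⟩
  · exact ⟨x, hxy, (hm x).mpr (Or.inl rfl), fun e he => ((hm e).mp he).symm⟩

theorem exists_opposite (S : TriSurface n) {u v : Fin n} (huv : u ≠ v)
    (h : ∃ f ∈ S.faces, u ∈ f ∧ v ∈ f) : ∃ c, ({u, v, c} : Finset (Fin n)) ∈ S.faces := by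
  have h2 := S.card_opposite huv h
  obtain ⟨c, hc⟩ := Finset.card_pos.mp (h2 ▸ two_pos)
  exact ⟨c, (Finset.mem_filter.mp hc).2⟩

/-- A vertex link containing a 3-cycle has no further vertices. -/
theorem eq_of_triangle_in_link (S : TriSurface n) {v a b c w : Fin n}
    (hab : ({v, a, b} : Finset (Fin n)) ∈ S.faces)
    (hbc : ({v, b, c} : Finset (Fin n)) ∈ S.faces)
    (hac : ({v, a, c} : Finset (Fin n)) ∈ S.faces)
    (hw : w ≠ v) (hwf : ∃ f ∈ S.faces, v ∈ f ∧ w ∈ f) : w = a ∨ w = b ∨ w = c := by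
  obtain ⟨f, hf, hvf, hwf⟩ := hwf
  have hav := (S.ne_of_mem_faces hab).1.symm
  have hr := S.link_cycle v a w ⟨_, hab, by simp, by simp, hav⟩ ⟨f, hf, hvf, hwf, hw⟩
  have closed : ∀ {p q r e : Fin n}, ({v, p, q} : Finset (Fin n)) ∈ S.faces →
      ({v, p, r} : Finset (Fin n)) ∈ S.faces → q ≠ r →
      ({v, p, e} : Finset (Fin n)) ∈ S.faces → e = q ∨ e = r := by
    intro p q r e hq hr hqr he
    obtain ⟨d, -, -, hd⟩ := S.exists_other_opposite hq
    have := hd r hr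
    have := hd e he
    grind
  have hba : ({v, b, a} : Finset (Fin n)) ∈ S.faces := Finset.pair_comm a b ▸ hab
  have hcb : ({v, c, b} : Finset (Fin n)) ∈ S.faces := Finset.pair_comm b c ▸ hbc
  have hca : ({v, c, a} : Finset (Fin n)) ∈ S.faces := Finset.pair_comm a c ▸ hac
  have nab := (S.ne_of_mem_faces hab).2.2
  have nbc := (S.ne_of_mem_faces hbc).2.2
  have nac := (S.ne_of_mem_faces hac).2.2
  clear hwf hw
  induction hr with
  | refl => exact Or.inl rfl
  | tail _ hstep ih =>
    obtain ⟨-, -, -, hs⟩ := hstep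
    rcases ih with rfl | rfl | rfl
    · have := closed hab hac nbc hs
      tauto
    · have := closed hba hbc nac hs
      tauto
    · have := closed hca hcb nab hs
      tauto

theorem exists_avoiding_six (a b c d e f : Fin 7) :
    ∃ x, x ≠ a ∧ x ≠ b ∧ x ≠ c ∧ x ≠ d ∧ x ≠ e ∧ x ≠ f := by
  have h : ({a, b, c, d, e, f} : Finset (Fin 7)).card < (Finset.univ : Finset (Fin 7)).card :=
    lt_of_le_of_lt Finset.card_le_six (by simp)
  obtain ⟨x, -, hx⟩ := Finset.exists_mem_notMem_of_card_lt_card h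
  exact ⟨x, by simpa using hx⟩

/-- In a neighborly 7-vertex surface no vertex link contains a 3-cycle. -/
theorem no_triangle_in_link (S : TriSurface 7) (h : S.eulerChar = 0) {v a b c : Fin 7}
    (hab : ({v, a, b} : Finset (Fin 7)) ∈ S.faces)
    (hbc : ({v, b, c} : Finset (Fin 7)) ∈ S.faces)
    (hac : ({v, a, c} : Finset (Fin 7)) ∈ S.faces) : False := by
  obtain ⟨w, hv, ha, hb, hc, -⟩ := exists_avoiding_six v a b c c c
  have := S.eq_of_triangle_in_link hab hbc hac hv
    (S.exists_face_of_eulerChar_eq_zero h v w hv.symm)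
  tauto

/-- The link of a vertex of a 7-vertex surface with `χ = 0` is a hexagon; the labels are chosen
so that it becomes the cycle of powers of `3` modulo `7`. -/
theorem exists_hexagon_link (S : TriSurface 7) (h : S.eulerChar = 0) :
    ∃ σ : Equiv.Perm (Fin 7),
      ({σ 0, σ 1, σ 3} : Finset (Fin 7)) ∈ S.faces ∧ {σ 0, σ 3, σ 2} ∈ S.faces ∧
      {σ 0, σ 2, σ 6} ∈ S.faces ∧ {σ 0, σ 6, σ 4} ∈ S.faces ∧
      {σ 0, σ 4, σ 5} ∈ S.faces ∧ {σ 0, σ 5, σ 1} ∈ S.faces := by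
  obtain ⟨t, ht⟩ : ∃ t : Fin 7 → Fin 7 → Prop,
      ∀ x y, t x y ↔ ({0, x, y} : Finset (Fin 7)) ∈ S.faces := ⟨_, fun _ _ => Iff.rfl⟩
  have symm : ∀ {x y}, t x y → t y x := by
    intro x y hxy
    rw [ht] at hxy ⊢
    rwa [Finset.pair_comm]
  have hne : ∀ {x y}, t x y → x ≠ 0 ∧ y ≠ 0 ∧ x ≠ y := by
    intro x y hxy
    have := S.ne_of_mem_faces ((ht x y).mp hxy)
    exact ⟨this.1.symm, this.2.1.symm, this.2.2⟩
  have ex : ∀ x, x ≠ 0 → ∃ y, t x y := by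
    intro x hx
    simp only [ht]
    exact S.exists_opposite hx.symm (S.exists_face_of_eulerChar_eq_zero h 0 x hx.symm)
  have other : ∀ {x y}, t x y → ∃ z, z ≠ y ∧ t x z ∧ ∀ e, t x e → e = y ∨ e = z := by
    intro x y hxy
    simp only [ht] at hxy ⊢
    exact S.exists_other_opposite hxy
  have tri : ∀ {x y z}, t x y → t y z → t x z → False := by
    intro x y z
    simp only [ht]
    exact S.no_triangle_in_link h
  obtain ⟨b, hab⟩ := ex 1 (by decide)
  obtain ⟨f, hfb, haf, ha⟩ := other hab
  obtain ⟨c, hca, hbc, hb⟩ := other (symm hab)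
  obtain ⟨e, hea, hfe, hf⟩ := other (symm haf)
  have hcf : c ≠ f := by
    rintro rfl
    exact tri hab hbc haf
  have heb : e ≠ b := by
    rintro rfl
    exact tri hab (symm hfe) haf
  obtain ⟨-, hb0, h1b⟩ := hne hab
  obtain ⟨-, hc0, hbc'⟩ := hne hbc
  obtain ⟨hf0, he0, hfe'⟩ := hne hfe
  obtain ⟨-, -, h1f⟩ := hne haf
  have h10 : (1 : Fin 7) ≠ 0 := by decide
  have hce : c ≠ e := by
    rintro rfl
    obtain ⟨z, -, -, hc⟩ := other (symm hbc)
    have hzf : z = f := ((hc f (symm hfe)).resolve_left hfb).symm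
    obtain ⟨d, hd0, hd1, hdb, hdc, hdf, -⟩ := exists_avoiding_six 0 1 b c f f
    obtain ⟨p, hdp⟩ := ex d hd0
    obtain ⟨q, hqp, hdq, -⟩ := other hdp
    have key : ∀ r, t d r → r ≠ 0 ∧ r ≠ 1 ∧ r ≠ b ∧ r ≠ c ∧ r ≠ f ∧ r ≠ d := by
      intro r hr
      refine ⟨(hne hr).2.1, ?_, ?_, ?_, ?_, (hne hr).2.2.symm⟩ <;> rintro rfl
      · exact (ha d (symm hr)).elim hdb hdf
      · exact (hb d (symm hr)).elim hd1 hdc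
      · exact (hc d (symm hr)).elim hdb (hzf ▸ hdf)
      · exact (hf d (symm hr)).elim hd1 hdc
    obtain ⟨hp0, hp1, hpb, hpc, hpf, hpd⟩ := key p hdp
    obtain ⟨hq0, hq1, hqb, hqc, hqf, hqd⟩ := key q hdq
    refine not_eight_distinct [0, 1, b, c, f, d, p, q] rfl ?_
    simp only [List.nodup_cons, List.mem_cons, List.not_mem_nil, not_or]
    and_intros <;> first
      | assumption
      | exact Ne.symm (by assumption)
      | exact not_false
      | exact List.nodup_nil
  obtain ⟨d, hd0, hd1, hdb, hdc, hde, hdf⟩ := exists_avoiding_six 0 1 b c e f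
  have key : ∀ r, t d r → r = c ∨ r = e := by
    intro r hr
    by_contra hcon
    obtain ⟨hrc, hre⟩ := not_or.mp hcon
    obtain ⟨-, hr0, hdr⟩ := hne hr
    have hr1 : r ≠ 1 := by
      rintro rfl
      exact (ha d (symm hr)).elim hdb hdf
    have hrb : r ≠ b := by
      rintro rfl
      exact (hb d (symm hr)).elim hd1 hdc
    have hrf : r ≠ f := by
      rintro rfl
      exact (hf d (symm hr)).elim hd1 hde
    refine not_eight_distinct [0, 1, b, c, d, e, f, r] rfl ?_
    simp only [List.nodup_cons, List.mem_cons, List.not_mem_nil, not_or]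
    and_intros <;> first
      | assumption
      | exact Ne.symm (by assumption)
      | exact not_false
      | exact List.nodup_nil
  obtain ⟨p, hdp⟩ := ex d hd0
  obtain ⟨q, hqp, hdq, -⟩ := other hdp
  have hdce : t d c ∧ t d e := by
    rcases key p hdp with rfl | rfl <;> rcases key q hdq with rfl | rfl
    · exact absurd rfl hqp
    · exact ⟨hdp, hdq⟩
    · exact ⟨hdq, hdp⟩
    · exact absurd rfl hqp
  have hinj : Function.Injective ![0, 1, c, b, e, f, d] := by
    rw [← List.nodup_ofFn]
    change [0, 1, c, b, e, f, d].Nodup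
    simp only [List.nodup_cons, List.mem_cons, List.not_mem_nil, not_or]
    and_intros <;> first
      | assumption
      | exact Ne.symm (by assumption)
      | exact not_false
      | exact List.nodup_nil
  refine ⟨Equiv.ofBijective _ (Finite.injective_iff_bijective.mp hinj), ?_⟩
  simp only [Equiv.ofBijective_apply]
  exact ⟨(ht _ _).mp hab, (ht _ _).mp hbc, (ht _ _).mp (symm hdce.1), (ht _ _).mp hdce.2,
    (ht _ _).mp (symm hfe), (ht _ _).mp (symm haf)⟩

/-- Möbius' torus in its cyclic labelling modulo `7`. -/
def mobiusFaces : Finset (Finset (Fin 7)) :=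
  Finset.univ.image (fun i => {i, i + 1, i + 3}) ∪ Finset.univ.image (fun i => {i, i + 2, i + 3})

/-- The indicator of the triangles of `S`, read in the labelling `σ`. -/
noncomputable def faceIndicator (S : TriSurface 7) (σ : Equiv.Perm (Fin 7)) (a b c : Fin 7) : ℕ :=
  if ({σ a, σ b, σ c} : Finset (Fin 7)) ∈ S.faces then 1 else 0

theorem faceIndicator_left_comm (S : TriSurface 7) (σ : Equiv.Perm (Fin 7)) (a b c : Fin 7) :
    S.faceIndicator σ a b c = S.faceIndicator σ b a c := by
  simp only [faceIndicator, Finset.insert_comm]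

theorem faceIndicator_right_comm (S : TriSurface 7) (σ : Equiv.Perm (Fin 7)) (a b c : Fin 7) :
    S.faceIndicator σ a b c = S.faceIndicator σ a c b := by
  simp only [faceIndicator, Finset.pair_comm]

theorem faceIndicator_self (S : TriSurface 7) (σ : Equiv.Perm (Fin 7)) (a c : Fin 7) :
    S.faceIndicator σ a a c = 0 :=
  if_neg fun h => (S.ne_of_mem_faces h).1 rfl

theorem faceIndicator_le_one (S : TriSurface 7) (σ : Equiv.Perm (Fin 7)) (a b c : Fin 7) :
    S.faceIndicator σ a b c ≤ 1 := by
  unfold faceIndicator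
  split_ifs <;> simp

theorem sum_faceIndicator (S : TriSurface 7) (h : S.eulerChar = 0) (σ : Equiv.Perm (Fin 7))
    (a b : Fin 7) (hab : a ≠ b) : ∑ c, S.faceIndicator σ a b c = 2 := by
  have hne := σ.injective.ne hab
  rw [← S.card_opposite hne (S.exists_face_of_eulerChar_eq_zero h _ _ hne),
    Finset.card_filter,
    ← Equiv.sum_comp σ (fun c => if ({σ a, σ b, c} : Finset (Fin 7)) ∈ S.faces then 1 else 0)]
  rfl

theorem faceIndicator_link_le_two (S : TriSurface 7) (h : S.eulerChar = 0)
    (σ : Equiv.Perm (Fin 7)) (v a b c : Fin 7) :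
    S.faceIndicator σ v a b + S.faceIndicator σ v b c + S.faceIndicator σ v a c ≤ 2 := by
  have := S.no_triangle_in_link h (v := σ v) (a := σ a) (b := σ b) (c := σ c)
  unfold faceIndicator
  grind

/-- The number of triangles on each edge forces the triangles off the link of a vertex. -/
theorem eq_one_of_hexagon_equations
    {a124 a356 a134 a136 a234 a235 a126 a256 a146 a346 a245 a345 a125 a156 : ℕ}
    (o13 : a134 + a136 = 1)
    (o23 : a234 + a235 = 1)
    (o26 : a126 + a256 = 1)
    (o46 : a146 + a346 = 1)
    (o45 : a245 + a345 = 1)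
    (o15 : a125 + a156 = 1)
    (d12 : a124 + a125 + a126 = 2)
    (d24 : a124 + a234 + a245 = 2)
    (d14 : a124 + a134 + a146 = 2)
    (d35 : a235 + a345 + a356 = 2)
    (g34 : a134 + a234 + a345 + a346 = 2)
    (g25 : a125 + a235 + a245 + a256 = 2)
    (b124 : a124 ≤ 1) (b356 : a356 ≤ 1) (b134 : a134 = 0 ∨ a134 = 1) :
    (a124 = 1 ∧ a235 = 1 ∧ a346 = 1 ∧ a156 = 1 ∧
        a134 = 1 ∧ a245 = 1 ∧ a356 = 1 ∧ a126 = 1) ∨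
      (a124 = 1 ∧ a345 = 1 ∧ a256 = 1 ∧ a136 = 1 ∧
        a125 = 1 ∧ a234 = 1 ∧ a356 = 1 ∧ a146 = 1) := by
  have m124 : a124 = 1 := by omega
  have m356 : a356 = 1 := by omega
  rcases b134 with m134 | m134
  · right
    refine ⟨m124, ?_, ?_, ?_, ?_, ?_, m356, ?_⟩ <;> omega
  · left
    refine ⟨m124, ?_, ?_, ?_, m134, ?_, m356, ?_⟩ <;> omega

/-- The reflection of the hexagon `1, 3, 2, 6, 4, 5` that fixes the vertices `1` and `6`. -/
def hexagonReflection : Equiv.Perm (Fin 7) :=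
  Equiv.swap 3 5 * Equiv.swap 2 4

/-- The link of one vertex determines the surface up to a reflection. -/
theorem exists_cyclic_labelling (S : TriSurface 7) (h : S.eulerChar = 0) :
    ∃ σ : Equiv.Perm (Fin 7), ∀ i : Fin 7,
      S.faceIndicator σ i (i + 1) (i + 3) = 1 ∧ S.faceIndicator σ i (i + 2) (i + 3) = 1 := by
  obtain ⟨σ, h1, h2, h3, h4, h5, h6⟩ := S.exists_hexagon_link h
  obtain ⟨x, hx⟩ : ∃ x, x = S.faceIndicator σ := ⟨_, rfl⟩
  have hlc : ∀ a b c, x a b c = x b a c := hx ▸ S.faceIndicator_left_comm σ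
  have hrc : ∀ a b c, x a b c = x a c b := hx ▸ S.faceIndicator_right_comm σ
  have hself : ∀ a c, x a a c = 0 := hx ▸ S.faceIndicator_self σ
  have hself' : ∀ a c, x a c c = 0 := fun a c => by
    rw [hlc a c c, hrc c a c, hself]
  have hle : ∀ a b c, x a b c ≤ 1 := hx ▸ S.faceIndicator_le_one σ
  have hlink : ∀ v a b c, x v a b + x v b c + x v a c ≤ 2 :=
    hx ▸ S.faceIndicator_link_le_two h σ
  have hsum : ∀ a b, a ≠ b → x a b 0 + x a b 1 + x a b 2 + x a b 3 + x a b 4 + x a b 5 +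
      x a b 6 = 2 := by
    intro a b hab
    rw [hx, ← S.sum_faceIndicator h σ a b hab]
    exact (Fin.sum_univ_seven _).symm
  have k1 : x 0 1 3 = 1 := by rw [hx]; exact if_pos h1
  have k2 : x 0 2 3 = 1 := by rw [hrc, hx]; exact if_pos h2
  have k3 : x 0 2 6 = 1 := by rw [hx]; exact if_pos h3
  have k4 : x 0 4 6 = 1 := by rw [hrc, hx]; exact if_pos h4
  have k5 : x 0 4 5 = 1 := by rw [hx]; exact if_pos h5
  have k6 : x 0 1 5 = 1 := by rw [hrc, hx]; exact if_pos h6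
  have s12 := hsum 1 2 (by decide)
  have s13 := hsum 1 3 (by decide)
  have s14 := hsum 1 4 (by decide)
  have s15 := hsum 1 5 (by decide)
  have s23 := hsum 2 3 (by decide)
  have s24 := hsum 2 4 (by decide)
  have s25 := hsum 2 5 (by decide)
  have s26 := hsum 2 6 (by decide)
  have s34 := hsum 3 4 (by decide)
  have s35 := hsum 3 5 (by decide)
  have s45 := hsum 4 5 (by decide)
  have s46 := hsum 4 6 (by decide)
  have s01 := hsum 0 1 (by decide)
  have s02 := hsum 0 2 (by decide)
  have s03 := hsum 0 3 (by decide)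
  have l1 := hlink 3 0 1 2
  have l2 := hlink 2 0 3 6
  have l3 := hlink 6 0 2 4
  have l4 := hlink 4 0 6 5
  have l5 := hlink 5 0 4 1
  have l6 := hlink 1 0 5 3
  simp only [hlc, hrc, hself, hself'] at s12 s13 s14 s15 s23 s24 s25 s26 s34 s35 s45 s46
  simp only [hlc, hrc, hself, hself'] at s01 s02 s03 l1 l2 l3 l4 l5 l6
  have key : (x 1 2 4 = 1 ∧ x 2 3 5 = 1 ∧ x 3 4 6 = 1 ∧ x 1 5 6 = 1 ∧
        x 1 3 4 = 1 ∧ x 2 4 5 = 1 ∧ x 3 5 6 = 1 ∧ x 1 2 6 = 1) ∨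
      (x 1 2 4 = 1 ∧ x 3 4 5 = 1 ∧ x 2 5 6 = 1 ∧ x 1 3 6 = 1 ∧
        x 1 2 5 = 1 ∧ x 2 3 4 = 1 ∧ x 3 5 6 = 1 ∧ x 1 4 6 = 1) := by
    have b134 := Nat.le_one_iff_eq_zero_or_eq_one.mp (hle 1 3 4)
    have b124 := hle 1 2 4
    have b356 := hle 3 5 6
    obtain ⟨z012, z014⟩ : x 0 1 2 = 0 ∧ x 0 1 4 = 0 := by clear * - s01 k1 k6; omega
    obtain ⟨z024, z025⟩ : x 0 2 4 = 0 ∧ x 0 2 5 = 0 := by clear * - s02 k2 k3; omega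
    obtain ⟨z034, z035⟩ : x 0 3 4 = 0 ∧ x 0 3 5 = 0 := by clear * - s03 k1 k2; omega
    have n123 : x 1 2 3 = 0 := by clear * - l1 k1 k2; omega
    have n236 : x 2 3 6 = 0 := by clear * - l2 k2 k3; omega
    have n246 : x 2 4 6 = 0 := by clear * - l3 k3 k4; omega
    have n456 : x 4 5 6 = 0 := by clear * - l4 k4 k5; omega
    have n145 : x 1 4 5 = 0 := by clear * - l5 k5 k6; omega
    have n135 : x 1 3 5 = 0 := by clear * - l6 k6 k1; omega
    exact eq_one_of_hexagon_equations
      (by clear * - s13 k1 n123 n135; omega)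
      (by clear * - s23 k2 n123 n236; omega)
      (by clear * - s26 k3 n236 n246; omega)
      (by clear * - s46 k4 n246 n456; omega)
      (by clear * - s45 k5 n145 n456; omega)
      (by clear * - s15 k6 n135 n145; omega)
      (by clear * - s12 z012 n123; omega)
      (by clear * - s24 z024 n246; omega)
      (by clear * - s14 z014 n145; omega)
      (by clear * - s35 z035 n135; omega)
      (by clear * - s34 z034; omega)
      (by clear * - s25 z025; omega)
      b124 b356 b134
  rcases key with ⟨m1, m2, m3, m4, m5, m6, m7, m8⟩ | ⟨m1, m2, m3, m4, m5, m6, m7, m8⟩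
  · refine ⟨σ, ?_⟩
    rw [← hx]
    intro i
    fin_cases i <;> simp [hlc, hrc, k1, k2, k3, k4, k5, k6, m1, m2, m3, m4, m5, m6, m7, m8]
  · refine ⟨σ * hexagonReflection, fun i => ?_⟩
    change S.faceIndicator σ (hexagonReflection i) (hexagonReflection (i + 1))
      (hexagonReflection (i + 3)) = 1 ∧ S.faceIndicator σ (hexagonReflection i)
      (hexagonReflection (i + 2)) (hexagonReflection (i + 3)) = 1
    rw [← hx]
    have r0 : hexagonReflection 0 = 0 := by decide
    have r1 : hexagonReflection 1 = 1 := by decide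
    have r2 : hexagonReflection 2 = 4 := by decide
    have r3 : hexagonReflection 3 = 5 := by decide
    have r4 : hexagonReflection 4 = 2 := by decide
    have r5 : hexagonReflection 5 = 3 := by decide
    have r6 : hexagonReflection 6 = 6 := by decide
    fin_cases i <;> simp [r0, r1, r2, r3, r4, r5, r6, hlc, hrc, k1, k2, k3, k4, k5, k6,
      m1, m2, m3, m4, m5, m6, m7, m8]

theorem exists_faces_iff (S : TriSurface 7) (h : S.eulerChar = 0) :
    ∃ σ : Equiv.Perm (Fin 7), ∀ f, f.image σ ∈ S.faces ↔ f ∈ mobiusFaces := by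
  obtain ⟨σ, hσ⟩ := S.exists_cyclic_labelling h
  have hinj : Function.Injective (Finset.image σ) := Finset.image_injective σ.injective
  have hsub : mobiusFaces.image (Finset.image σ) ⊆ S.faces := by
    intro f hf
    simp only [mobiusFaces, Finset.mem_image, Finset.mem_union, Finset.mem_univ, true_and] at hf
    obtain ⟨g, ⟨i, rfl⟩ | ⟨i, rfl⟩, rfl⟩ := hf
    · have := (hσ i).1
      simp only [faceIndicator] at this
      simpa [Finset.image_insert] using this
    · have := (hσ i).2
      simp only [faceIndicator] at this
      simpa [Finset.image_insert] using this
  have hcard : mobiusFaces.card = 14 := by decide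
  have h2 := S.two_mul_card_edges
  unfold eulerChar at h
  push_cast at h
  have heq := Finset.eq_of_subset_of_card_le hsub
    (by rw [Finset.card_image_of_injective _ hinj]; omega)
  refine ⟨σ, fun f => ?_⟩
  rw [← heq]
  exact hinj.mem_finset_image

/-- Möbius' torus is oriented so that the directed edges of the triangles `{i, i + 1, i + 3}` have
differences `1, 2, 4` and those of the triangles `{i, i + 2, i + 3}` differences `3, 5, 6`. -/
def mobiusOrientation (f : Finset (Fin 7)) : Finset (Fin 7 × Fin 7) :=
  (f ×ˢ f).filter fun p =>
    p.2 - p.1 ∈ if ∃ i : Fin 7, f = {i, i + 1, i + 3} then ({1, 2, 4} : Finset (Fin 7))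
      else {3, 5, 6}

theorem mobiusOrientation_cyclic : ∀ f ∈ mobiusFaces, ∃ a b c : Fin 7,
    a ≠ b ∧ a ≠ c ∧ b ≠ c ∧ f = {a, b, c} ∧
      mobiusOrientation f = {(a, b), (b, c), (c, a)} := by
  intro f hf
  simp only [mobiusFaces, Finset.mem_image, Finset.mem_union, Finset.mem_univ, true_and] at hf
  obtain ⟨i, rfl⟩ | ⟨i, rfl⟩ := hf
  · refine ⟨i, i + 1, i + 3, ?_⟩
    revert i
    decide
  · refine ⟨i, i + 3, i + 2, ?_⟩
    revert i
    decide

set_option maxRecDepth 20000 in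
theorem mobiusOrientation_disjoint : ∀ f ∈ mobiusFaces, ∀ g ∈ mobiusFaces, f ≠ g →
    ∀ p ∈ mobiusOrientation f, p ∉ mobiusOrientation g := by
  decide

theorem orientable_of_eulerChar_eq_zero (S : TriSurface 7) (h : S.eulerChar = 0) :
    S.Orientable := by
  obtain ⟨σ, hσ⟩ := S.exists_faces_iff h
  have hinv : ∀ f : Finset (Fin 7), (f.image σ.symm).image σ = f := by
    intro f
    simp [Finset.image_image]
  have hM : ∀ f ∈ S.faces, f.image σ.symm ∈ mobiusFaces := by
    intro f hf
    rwa [← hσ, hinv]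
  have hpair : Function.Injective (Prod.map σ σ) := σ.injective.prodMap σ.injective
  refine ⟨fun f => (mobiusOrientation (f.image σ.symm)).image (Prod.map σ σ), ?_, ?_⟩
  · intro f hf
    obtain ⟨a, b, c, hab, hac, hbc, hf', ho⟩ := mobiusOrientation_cyclic _ (hM f hf)
    refine ⟨σ a, σ b, σ c, σ.injective.ne hab, σ.injective.ne hac, σ.injective.ne hbc, ?_, ?_⟩
    · rw [← hinv f, hf']
      simp [Finset.image_insert]
    · simp [ho, Finset.image_insert]
  · intro f hf g hg hfg p hpf hpg
    obtain ⟨q, hq, rfl⟩ := Finset.mem_image.mp hpf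
    refine mobiusOrientation_disjoint _ (hM f hf) _ (hM g hg) ?_ q hq
      (hpair.mem_finset_image.mp hpg)
    exact (Finset.image_injective σ.symm.injective).ne hfg

theorem iso_of_eulerChar_eq_zero (S T : TriSurface 7) (hS : S.eulerChar = 0)
    (hT : T.eulerChar = 0) : S.Iso T := by
  obtain ⟨σ, hσ⟩ := S.exists_faces_iff hS
  obtain ⟨τ, hτ⟩ := T.exists_faces_iff hT
  refine ⟨σ.symm.trans τ, fun f => ?_⟩
  have h1 : (f.image σ.symm).image σ = f := by simp [Finset.image_image]
  have h2 : f.image (σ.symm.trans τ) = (f.image σ.symm).image τ := by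
    rw [Finset.image_image]
    rfl
  rw [h2, hτ, ← hσ, h1]

end TriSurface

/-- Every triangulated surface with 7 vertices and Euler characteristic 0 is orientable,
and any two such surfaces are combinatorially isomorphic: Möbius' 7-vertex torus is the
unique 7-vertex triangulation with Euler characteristic 0. -/
theorem seven_vertex_torus_unique :
    (∀ S : TriSurface 7, S.eulerChar = 0 → S.Orientable) ∧
    (∀ S T : TriSurface 7, S.eulerChar = 0 → T.eulerChar = 0 → S.Iso T) := by
  exact ⟨TriSurface.orientable_of_eulerChar_eq_zero, TriSurface.iso_of_eulerChar_eq_zero⟩
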